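/- The invariant ring R₂^{P₂} is a free module over the subalgebra 𝒜 of rank q(q²−1)². -/

import Mathlib

open MvPolynomial

noncomputable section

abbrev R2 (F : Type) [Field F] : Type := MvPolynomial (Fin 4) F

/-- The action of `A ∈ GL₂(F)` on `R₂ = F[x₁,x₂,y₁,y₂]` (variables `X 0, X 1, X 2, X 3`). -/
def act {F : Type} [Field F] (A : GL (Fin 2) F) : R2 F →ₐ[F] R2 F :=
  aeval ![C ((A.val.det)⁻¹ * A.val 1 1) * X 0 - C ((A.val.det)⁻¹ * A.val 1 0) * X 1,
          C ((A.val.det)⁻¹ * A.val 0 0) * X 1 - C ((A.val.det)⁻¹ * A.val 0 1) * X 0,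
          C (A.val 0 0) * X 2 + C (A.val 0 1) * X 3,
          C (A.val 1 0) * X 2 + C (A.val 1 1) * X 3]

/-- The invariant ring `R₂^G` for a subgroup `G ≤ GL₂(F)`. -/
def invariantRing {F : Type} [Field F] (G : Subgroup (GL (Fin 2) F)) : Subalgebra F (R2 F) where
  carrier := {f | ∀ A ∈ G, act A f = f}
  mul_mem' := fun hf hg A hA => by rw [map_mul, hf A hA, hg A hA]
  add_mem' := fun hf hg A hA => by rw [map_add, hf A hA, hg A hA]
  one_mem' := fun A _ => map_one (act A)
  zero_mem' := fun A _ => map_zero (act A)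
  algebraMap_mem' := fun r A _ => (act A).commutes r

/-- `SL₂(F)` as a subgroup of `GL₂(F)`. -/
def SL2 (F : Type) [Field F] : Subgroup (GL (Fin 2) F) where
  carrier := {A | A.val.det = 1}
  one_mem' := by simp
  mul_mem' := by
    intro a b ha hb
    simp only [Set.mem_setOf_eq, Units.val_mul, Matrix.det_mul] at *
    rw [ha, hb, mul_one]
  inv_mem' := by
    intro a ha
    have h : ((a⁻¹).val * a.val).det = 1 := by
      rw [← Units.val_mul, inv_mul_cancel, Units.val_one, Matrix.det_one]
    simp only [Matrix.det_mul] at h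
    rw [Set.mem_setOf_eq] at ha ⊢
    rw [ha, mul_one] at h
    exact h

/-- `P₂(F)`: upper triangular matrices in `SL₂(F)` with 1's on the diagonal. -/
def P2 (F : Type) [Field F] : Subgroup (GL (Fin 2) F) where
  carrier := {A | A.val 0 0 = 1 ∧ A.val 1 1 = 1 ∧ A.val 1 0 = 0}
  one_mem' := by simp
  mul_mem' := by
    intro a b ha hb
    obtain ⟨ha1, ha2, ha3⟩ := ha
    obtain ⟨hb1, hb2, hb3⟩ := hb
    refine ⟨?_, ?_, ?_⟩ <;>
      simp [Units.val_mul, Matrix.mul_apply, Fin.sum_univ_two, ha1, ha2, ha3, hb1, hb2, hb3]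
  inv_mem' := by
    intro a ha
    obtain ⟨ha1, ha2, ha3⟩ := ha
    have hdet : a.val.det = 1 := by
      rw [Matrix.det_fin_two, ha1, ha2, ha3]; ring
    have hinv : (a⁻¹).val = a.val⁻¹ := by
      simp [Matrix.coe_units_inv]
    refine ⟨?_, ?_, ?_⟩ <;>
      simp [hinv, Matrix.inv_def, hdet, Matrix.adjugate_fin_two, ha1, ha2, ha3]

def d22 (F : Type) [Field F] (q : ℕ) : R2 F := X 1 * X 0 ^ q - X 0 * X 1 ^ q
def d22s (F : Type) [Field F] (q : ℕ) : R2 F := X 2 * X 3 ^ q - X 3 * X 2 ^ q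
def u0 (F : Type) [Field F] : R2 F := X 0 * X 2 + X 1 * X 3
def u1 (F : Type) [Field F] (q : ℕ) : R2 F := X 0 ^ q * X 2 + X 1 ^ q * X 3
def u1s (F : Type) [Field F] (q : ℕ) : R2 F := X 0 * X 2 ^ q + X 1 * X 3 ^ q
def phi1 (F : Type) [Field F] : R2 F := X 0
def phi2 (F : Type) [Field F] (q : ℕ) : R2 F := X 1 ^ q - X 1 * X 0 ^ (q - 1)
def phi1s (F : Type) [Field F] : R2 F := X 3
def phi2s (F : Type) [Field F] (q : ℕ) : R2 F := X 2 ^ q - X 2 * X 3 ^ (q - 1)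

/-- Univariate polynomials over a commutative ring, with the semiring structure of the
coefficients always obtained from the commutative ring structure. -/
abbrev PolyRing (S : Type*) [CommRing S] : Type _ := Polynomial S

section FreeVia

variable {A B D ι κ : Type*} [CommRing A] [CommRing B] [CommRing D]

section Sums

variable [Fintype ι] [Fintype κ]

/-- The elements `e i` are linearly independent over `A` acting through `φ`. -/
def IndepVia (φ : A →+* B) (e : ι → B) : Prop :=
  ∀ c : ι → A, ∑ i, φ (c i) * e i = 0 → c = 0

/-- The elements `e i` span the set `M` over `A` acting through `φ`. -/
def SpanVia (φ : A →+* B) (e : ι → B) (M : Set B) : Prop :=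
  ∀ b ∈ M, ∃ c : ι → A, ∑ i, φ (c i) * e i = b

lemma sum_comp_via (φ : A →+* B) (ψ : B →+* D) (e : ι → B) (e' : κ → D) (c : κ × ι → A) :
    ∑ z, (ψ.comp φ) (c z) * (ψ (e z.2) * e' z.1) =
      ∑ j, ψ (∑ i, φ (c (j, i)) * e i) * e' j := by
  rw [Fintype.sum_prod_type]
  refine Finset.sum_congr rfl fun j _ => ?_
  rw [map_sum, Finset.sum_mul]
  refine Finset.sum_congr rfl fun i _ => ?_
  simp only [RingHom.comp_apply, map_mul]
  ring

lemma IndepVia.comp {φ : A →+* B} {ψ : B →+* D} {e : ι → B} {e' : κ → D}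
    (h : IndepVia φ e) (h' : IndepVia ψ e') :
    IndepVia (ψ.comp φ) (fun z : κ × ι => ψ (e z.2) * e' z.1) := by
  intro c hc
  rw [sum_comp_via] at hc
  have h1 := h' _ hc
  funext ⟨j, i⟩
  exact congrFun (h (fun i => c (j, i)) (congrFun h1 j)) i

lemma SpanVia.comp {φ : A →+* B} {ψ : B →+* D} {e : ι → B} {e' : κ → D} {M : Set D}
    (h : SpanVia φ e Set.univ) (h' : SpanVia ψ e' M) :
    SpanVia (ψ.comp φ) (fun z : κ × ι => ψ (e z.2) * e' z.1) M := by
  intro b hb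
  obtain ⟨c, rfl⟩ := h' b hb
  choose g hg using fun j => h (c j) trivial
  exact ⟨fun z => g z.1 z.2, by rw [sum_comp_via]; simp only [hg]⟩

lemma IndepVia.map {φ : A →+* B} {e : ι → B} (h : IndepVia φ e) :
    IndepVia (Polynomial.mapRingHom φ) (fun i => Polynomial.C (e i)) := by
  intro c hc
  funext i
  ext n
  have h1 := congrArg (fun p => Polynomial.coeff p n) hc
  simp only [Polynomial.finsetSum_coeff, Polynomial.coeff_mul_C, Polynomial.coe_mapRingHom,
    Polynomial.coeff_map, Polynomial.coeff_zero] at h1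
  exact congrFun (h (fun i => (c i).coeff n) h1) i

lemma SpanVia.map {φ : A →+* B} {e : ι → B} (h : SpanVia φ e Set.univ) :
    SpanVia (Polynomial.mapRingHom φ) (fun i => Polynomial.C (e i)) Set.univ := by
  intro b _
  induction b using Polynomial.induction_on' with
  | add p q hp hq =>
    obtain ⟨c, rfl⟩ := hp trivial
    obtain ⟨d, rfl⟩ := hq trivial
    exact ⟨c + d, by simp [add_mul, Finset.sum_add_distrib]⟩
  | monomial n a =>
    obtain ⟨c, rfl⟩ := h a trivial
    refine ⟨fun i => Polynomial.monomial n (c i), ?_⟩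
    simp [Polynomial.monomial_mul_C]

end Sums

lemma eq_zero_of_descent (x : A) (hx : ∀ w : A, (∀ k, x ^ k ∣ w) → w = 0)
    (P : (ι → A) → Prop) (h : ∀ c, P c → ∃ c', P c' ∧ ∀ i, c i = x * c' i)
    (c : ι → A) (hc : P c) : c = 0 := by
  have key : ∀ k, ∃ c', P c' ∧ ∀ i, c i = x ^ k * c' i := by
    intro k
    induction k with
    | zero => exact ⟨c, hc, by simp⟩
    | succ k ih =>
      obtain ⟨c', hc', he⟩ := ih
      obtain ⟨c'', hc'', he'⟩ := h c' hc'
      exact ⟨c'', hc'', fun i => by rw [he, he', pow_succ, mul_assoc]⟩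
  funext i
  refine hx _ fun k => ?_
  obtain ⟨c', -, he⟩ := key k
  exact ⟨_, he i⟩

end FreeVia

section PolynomialLemmas

variable {S T U : Type*} [CommRing S] [CommRing T] [CommRing U]

lemma eq_zero_of_X_pow_dvd (w : Polynomial S) (h : ∀ k, Polynomial.X ^ k ∣ w) : w = 0 := by
  ext n
  exact Polynomial.X_pow_dvd_iff.1 (h (n + 1)) n n.lt_succ_self

lemma eq_zero_of_C_X_pow_dvd (w : PolyRing (PolyRing S))
    (h : ∀ k, (Polynomial.C Polynomial.X) ^ k ∣ w) : w = 0 := by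
  ext1 n
  refine eq_zero_of_X_pow_dvd _ fun k => ?_
  have := h k
  rw [← Polynomial.C_pow, Polynomial.C_dvd_iff_dvd_coeff] at this
  exact this n

lemma exists_eq_C_X_mul (w : PolyRing (PolyRing S))
    (h : w.map (Polynomial.evalRingHom 0) = 0) : ∃ w', w = Polynomial.C Polynomial.X * w' := by
  refine (Polynomial.C_dvd_iff_dvd_coeff _ _).2 fun n => ?_
  rw [Polynomial.X_dvd_iff, Polynomial.coeff_zero_eq_eval_zero]
  simpa using congrArg (fun p => Polynomial.coeff p n) h

lemma indepVia_comp_monic (N : Polynomial S) (hN : N.Monic) (n : ℕ) (hn : N.natDegree = n) :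
    IndepVia (Polynomial.compRingHom N) (fun i : Fin n => Polynomial.X ^ (i : ℕ)) := by
  rcases subsingleton_or_nontrivial S with hS | hS
  · exact fun c _ => Subsingleton.elim _ _
  refine fun c hc => eq_zero_of_descent Polynomial.X eq_zero_of_X_pow_dvd
    (fun c => ∑ i : Fin n, Polynomial.compRingHom N (c i) * Polynomial.X ^ (i : ℕ) = 0) ?_ c hc
  intro c hc
  have hsplit : ∀ i, c i = Polynomial.X * (c i).divX + Polynomial.C ((c i).coeff 0) :=
    fun i => (Polynomial.X_mul_divX_add (c i)).symm
  have hsum : N * (∑ i, Polynomial.compRingHom N ((c i).divX) * Polynomial.X ^ (i : ℕ)) +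
      ∑ i : Fin n, Polynomial.C ((c i).coeff 0) * Polynomial.X ^ (i : ℕ) = 0 := by
    rw [← hc, Finset.mul_sum, ← Finset.sum_add_distrib]
    refine Finset.sum_congr rfl fun i _ => ?_
    have h := congrArg (Polynomial.compRingHom N) (hsplit i)
    rw [map_add, map_mul, Polynomial.coe_compRingHom_apply Polynomial.X N, Polynomial.X_comp,
      Polynomial.coe_compRingHom_apply (Polynomial.C _) N, Polynomial.C_comp] at h
    rw [h]
    ring
  have hdeg : (∑ i : Fin n, Polynomial.C ((c i).coeff 0) * Polynomial.X ^ (i : ℕ)).degree <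
      N.degree := by
    rw [Polynomial.degree_eq_natDegree hN.ne_zero, hn]
    exact Polynomial.degree_sum_fin_lt _
  have hmod := (Polynomial.div_modByMonic_unique (f := 0) _ _ hN
    ⟨by rw [add_comm]; exact hsum, hdeg⟩)
  have h1 := hmod.1
  have h2 := hmod.2
  rw [Polynomial.zero_divByMonic] at h1
  rw [Polynomial.zero_modByMonic] at h2
  refine ⟨fun i => (c i).divX, h1.symm, fun i => ?_⟩
  have h3 := congrArg (fun p => Polynomial.coeff p (i : ℕ)) h2
  simp only [Polynomial.finsetSum_coeff, Polynomial.coeff_C_mul, Polynomial.coeff_X_pow,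
    Polynomial.coeff_zero] at h3
  have h4 : (c i).coeff 0 = 0 := by
    rw [h3, Finset.sum_eq_single i]
    · simp
    · intro j _ hj
      rw [if_neg (fun h => hj (Fin.ext h.symm)), mul_zero]
    · simp
  conv_lhs => rw [hsplit i, h4]
  simp

/-- The extension of `f` to two variables, sending them to `a` and `b`. -/
def ev2 (f : S →+* T) (a b : T) : PolyRing (PolyRing S) →+* T :=
  Polynomial.eval₂RingHom (Polynomial.eval₂RingHom f a) b

@[simp] lemma ev2_C_C (f : S →+* T) (a b : T) (s : S) :
    ev2 f a b (Polynomial.C (Polynomial.C s)) = f s := by simp [ev2]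

@[simp] lemma ev2_C_X (f : S →+* T) (a b : T) :
    ev2 f a b (Polynomial.C Polynomial.X) = a := by simp [ev2]

@[simp] lemma ev2_X (f : S →+* T) (a b : T) : ev2 f a b Polynomial.X = b := by simp [ev2]

lemma comp_ev2 (g : T →+* U) (f : S →+* T) (a b : T) :
    g.comp (ev2 f a b) = ev2 (g.comp f) (g a) (g b) := by
  ext <;> simp

/-- The substitution `X ↦ s t`, `Y ↦ t ^ m + s ^ n` of `S[s][t]`. -/
def dicksonHom (S : Type*) [CommRing S] (m n : ℕ) :
    PolyRing (PolyRing S) →+* PolyRing (PolyRing S) :=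
  ev2 (Polynomial.C.comp Polynomial.C) (Polynomial.C Polynomial.X * Polynomial.X)
    (Polynomial.X ^ m + Polynomial.C Polynomial.X ^ n)

/-- The monomials `t ^ j` for `j < m` and `s ^ (i + 1)` for `i < n`. -/
def dicksonBasis (S : Type*) [CommRing S] (m n : ℕ) : Fin m ⊕ Fin n → PolyRing (PolyRing S) :=
  Sum.elim (fun j => Polynomial.X ^ (j : ℕ)) (fun i => Polynomial.C Polynomial.X ^ ((i : ℕ) + 1))

lemma dickson_indep [IsDomain S] (m n : ℕ) (hm : 0 < m) (hn : 0 < n) :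
    IndepVia (dicksonHom S m n) (dicksonBasis S m n) := by
  refine fun c hc => eq_zero_of_descent (Polynomial.C Polynomial.X) eq_zero_of_C_X_pow_dvd
    (fun c => ∑ i, dicksonHom S m n (c i) * dicksonBasis S m n i = 0) ?_ c hc
  intro c hc
  have e1 : (Polynomial.mapRingHom (Polynomial.evalRingHom (0 : S))).comp (dicksonHom S m n) =
      (Polynomial.compRingHom (Polynomial.X ^ m)).comp
        (Polynomial.mapRingHom (Polynomial.evalRingHom 0)) := by
    ext <;> simp [dicksonHom, hn.ne']
  have e2 : (Polynomial.evalRingHom (0 : Polynomial S)).comp (dicksonHom S m n) =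
      (Polynomial.compRingHom (Polynomial.X ^ n)).comp
        (Polynomial.mapRingHom (Polynomial.evalRingHom 0)) := by
    ext <;> simp [dicksonHom, hm.ne']
  have h1 := congrArg (Polynomial.mapRingHom (Polynomial.evalRingHom (0 : S))) hc
  have h2 := congrArg (Polynomial.evalRingHom (0 : Polynomial S)) hc
  simp only [map_sum, map_add, map_mul, map_zero, Fintype.sum_sum_type] at h1 h2
  simp only [← RingHom.comp_apply _ (dicksonHom S m n), e1] at h1
  simp only [← RingHom.comp_apply _ (dicksonHom S m n), e2] at h2
  have k1 := indepVia_comp_monic (Polynomial.X ^ m : Polynomial S) (Polynomial.monic_X_pow m) m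
    (Polynomial.natDegree_X_pow m)
    (fun j => (c (Sum.inl j)).map (Polynomial.evalRingHom 0)) (by
      simpa [dicksonBasis] using h1)
  have k2 := indepVia_comp_monic (Polynomial.X ^ n : Polynomial S) (Polynomial.monic_X_pow n) n
    (Polynomial.natDegree_X_pow n)
    (fun j => (c (Sum.inr j)).map (Polynomial.evalRingHom 0)) (by
      have k3 : ∀ j, (c (Sum.inl j)).map (Polynomial.evalRingHom 0) = 0 := fun j => congrFun k1 j
      simp only [RingHom.comp_apply, Polynomial.coe_mapRingHom, k3, map_zero, zero_mul,
        Finset.sum_const_zero, zero_add] at h2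
      refine (mul_eq_zero.1 (?_ : _ * (Polynomial.X : Polynomial S) = 0)).resolve_right
        Polynomial.X_ne_zero
      rw [← h2, Finset.sum_mul]
      refine Finset.sum_congr rfl fun i _ => ?_
      simp [dicksonBasis, pow_succ, mul_assoc])
  have k4 : ∀ i, ∃ w', c i = Polynomial.C Polynomial.X * w' := by
    rintro (j | j)
    · exact exists_eq_C_X_mul _ (congrFun k1 j)
    · exact exists_eq_C_X_mul _ (congrFun k2 j)
  choose c' hc' using k4
  refine ⟨c', ?_, hc'⟩
  have k5 : (Polynomial.C Polynomial.X * Polynomial.X : PolyRing (PolyRing S)) ≠ 0 := by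
    simp [Polynomial.X_ne_zero]
  refine (mul_eq_zero.1 (?_ : (Polynomial.C Polynomial.X * Polynomial.X) * _ = _)).resolve_left k5
  rw [← hc, Finset.mul_sum]
  refine Finset.sum_congr rfl fun i _ => ?_
  rw [hc' i, map_mul]
  simp only [dicksonHom, ev2_C_X]
  ring

lemma dickson_span (m n : ℕ) (hm : 0 < m) (hn : 0 < n) :
    SpanVia (dicksonHom S m n) (dicksonBasis S m n) Set.univ := by
  classical
  set M : Set (PolyRing (PolyRing S)) :=
    {b | ∃ c : Fin m ⊕ Fin n → _, ∑ i, dicksonHom S m n (c i) * dicksonBasis S m n i = b} with hM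
  have hadd : ∀ f ∈ M, ∀ g ∈ M, f + g ∈ M := by
    rintro _ ⟨c, rfl⟩ _ ⟨d, rfl⟩
    exact ⟨c + d, by simp [add_mul, Finset.sum_add_distrib]⟩
  have hmul : ∀ z, ∀ f ∈ M, dicksonHom S m n z * f ∈ M := by
    rintro z _ ⟨c, rfl⟩
    refine ⟨fun i => z * c i, ?_⟩
    rw [Finset.mul_sum]
    exact Finset.sum_congr rfl fun i _ => by rw [map_mul]; ring
  have hbas : ∀ i, dicksonBasis S m n i ∈ M := fun i => ⟨Pi.single i 1, by
    rw [Finset.sum_eq_single i] <;> simp +contextual⟩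
  have hx : ∀ f ∈ M, (Polynomial.C Polynomial.X * Polynomial.X) * f ∈ M := fun f hf => by
    simpa [dicksonHom] using hmul (Polynomial.C Polynomial.X) f hf
  have hy : ∀ f ∈ M, (Polynomial.X ^ m + Polynomial.C Polynomial.X ^ n) * f ∈ M := fun f hf => by
    simpa [dicksonHom] using hmul Polynomial.X f hf
  have hneg : ∀ f ∈ M, -f ∈ M := fun f hf => by
    have h : -f = dicksonHom S m n (-1) * f := by rw [map_neg, map_one]; ring
    exact h ▸ hmul (-1) f hf
  have hmon : ∀ w a b : ℕ, m * a + n * b = w →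
      (Polynomial.C Polynomial.X ^ a * Polynomial.X ^ b : PolyRing (PolyRing S)) ∈ M := by
    intro w
    induction w using Nat.strong_induction_on with
    | _ w ih =>
    intro a b hw
    rcases Nat.eq_zero_or_pos a with rfl | ha
    · rcases lt_or_ge b m with hb | hb
      · simpa [dicksonBasis] using hbas (Sum.inl ⟨b, hb⟩)
      · obtain ⟨b, rfl⟩ := Nat.exists_eq_add_of_le hb
        rcases Nat.eq_zero_or_pos b with rfl | hb'
        · have h1 := hy _ (by simpa [dicksonBasis] using hbas (Sum.inl ⟨0, hm⟩) : (1 : _) ∈ M)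
          have h2 := hbas (Sum.inr ⟨n - 1, by omega⟩)
          simp only [dicksonBasis, Sum.elim_inr, Nat.sub_add_cancel hn] at h2
          have := hadd _ h1 _ (hneg _ h2)
          simpa using this
        · obtain ⟨b, rfl⟩ := Nat.exists_eq_add_of_le' hb'
          obtain ⟨n', rfl⟩ := Nat.exists_eq_add_of_le' hn
          have h1 := hy _ (ih _ (by nlinarith) 0 (b + 1) rfl)
          have h2 := hx _ (ih _ (by nlinarith) n' b rfl)
          have := hadd _ h1 _ (hneg _ h2)
          convert this using 1
          ring
    · obtain ⟨a, rfl⟩ := Nat.exists_eq_add_of_le' ha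
      rcases Nat.eq_zero_or_pos b with rfl | hb
      · rcases lt_or_ge a n with han | han
        · simpa [dicksonBasis] using hbas (Sum.inr ⟨a, han⟩)
        · obtain ⟨a, rfl⟩ := Nat.exists_eq_add_of_le han
          obtain ⟨m', rfl⟩ := Nat.exists_eq_add_of_le' hm
          have h1 := hy _ (ih _ (by nlinarith) (a + 1) 0 rfl)
          have h2 := hx _ (ih _ (by nlinarith) a m' rfl)
          have := hadd _ h1 _ (hneg _ h2)
          convert this using 1
          ring
      · obtain ⟨b, rfl⟩ := Nat.exists_eq_add_of_le' hb
        have h2 := hx _ (ih _ (by nlinarith) a b rfl)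
        convert h2 using 1
        ring
  rintro f -
  change f ∈ M
  induction f using Polynomial.induction_on' with
  | add p q hp hq => exact hadd _ hp _ hq
  | monomial k a =>
    induction a using Polynomial.induction_on' with
    | add p q hp hq => rw [map_add]; exact hadd _ hp _ hq
    | monomial l s =>
      convert hmul (Polynomial.C (Polynomial.C s)) _ (hmon _ l k rfl) using 1
      simp only [dicksonHom, ev2_C_C, RingHom.comp_apply]
      rw [← Polynomial.C_mul_X_pow_eq_monomial, ← Polynomial.C_mul_X_pow_eq_monomial]
      simp only [map_mul, map_pow, mul_assoc]

end PolynomialLemmas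

section TranslationInvariants

variable {F L : Type*} [Field F] [Fintype F] [CommRing L] [Algebra F L]

lemma add_pow_card_field (x y : L) :
    (x + y) ^ Fintype.card F = x ^ Fintype.card F + y ^ Fintype.card F := by
  obtain ⟨p, hp⟩ := CharP.exists F
  obtain ⟨n, hpp, hn⟩ := FiniteField.card F p
  have : Fact p.Prime := ⟨hpp⟩
  have : ExpChar F p := ExpChar.prime hpp
  rcases subsingleton_or_nontrivial L with hL | hL
  · exact Subsingleton.elim _ _
  have : ExpChar L p := expChar_of_injective_algebraMap (algebraMap F L).injective p
  rw [hn, add_pow_expChar_pow]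

lemma algebraMap_pow_card (t : F) : algebraMap F L t ^ Fintype.card F = algebraMap F L t := by
  rw [← map_pow, FiniteField.pow_card]

lemma add_smul_orbit_poly (t : F) (b a : L) :
    (b + algebraMap F L t * a) ^ Fintype.card F -
        (b + algebraMap F L t * a) * a ^ (Fintype.card F - 1) =
      b ^ Fintype.card F - b * a ^ (Fintype.card F - 1) := by
  have h : a * a ^ (Fintype.card F - 1) = a ^ Fintype.card F :=
    mul_pow_sub_one Fintype.card_ne_zero a
  rw [add_pow_card_field, mul_pow, algebraMap_pow_card, add_mul, mul_assoc, h]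
  ring

lemma exists_comp_of_translation_invariant [IsDomain L] (a : L) (ha : a ≠ 0) (g : Polynomial L)
    (hg : ∀ t : F, g.comp (Polynomial.X + Polynomial.C (algebraMap F L t * a)) = g) :
    ∃ h : Polynomial L, g = h.comp (Polynomial.X ^ Fintype.card F -
      Polynomial.X * Polynomial.C a ^ (Fintype.card F - 1)) := by
  set q := Fintype.card F with hq
  have hq1 : 1 < q := Fintype.one_lt_card
  set N : Polynomial L := Polynomial.X ^ q - Polynomial.X * Polynomial.C a ^ (q - 1) with hN
  have hlt : (Polynomial.X * Polynomial.C a ^ (q - 1) : Polynomial L).degree < q := by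
    rw [← Polynomial.C_pow, mul_comm]
    exact (Polynomial.degree_C_mul_X_le _).trans_lt (by exact_mod_cast hq1)
  have hmon : N.Monic := Polynomial.monic_X_pow_sub hlt
  have hdeg : N.degree = q := by
    rw [hN, Polynomial.degree_sub_eq_left_of_degree_lt] <;> rw [Polynomial.degree_X_pow]
    exact hlt
  have hnat : N.natDegree = q := Polynomial.natDegree_eq_of_degree_eq_some hdeg
  have hNinv : ∀ t : F, N.comp (Polynomial.X + Polynomial.C (algebraMap F L t * a)) = N := by
    intro t
    have := add_smul_orbit_poly t (Polynomial.X : Polynomial L) (Polynomial.C a)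
    rw [Polynomial.algebraMap_apply, ← map_mul] at this
    rw [hN]
    simpa [hq] using this
  have hroot : ∀ t : F, N.eval (algebraMap F L t * a) = 0 := by
    intro t
    have := congrArg (Polynomial.eval 0) (hNinv t)
    simp only [Polynomial.eval_comp, Polynomial.eval_add, Polynomial.eval_X, Polynomial.eval_C,
      zero_add] at this
    rw [this, hN]
    simp [hq]
  induction hn : g.natDegree using Nat.strong_induction_on generalizing g with
  | _ n ih =>
  rcases Nat.eq_zero_or_pos n with rfl | hpos
  · exact ⟨g, by rw [Polynomial.eq_C_of_natDegree_eq_zero hn]; simp⟩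
  set f := g - Polynomial.C (g.eval 0) with hf
  have hroot' : ∀ t : F, (f %ₘ N).eval (algebraMap F L t * a) = 0 := by
    intro t
    have h1 := congrArg (Polynomial.eval (algebraMap F L t * a)) (Polynomial.modByMonic_add_div f N)
    have h2 := congrArg (Polynomial.eval 0) (hg t)
    simp only [Polynomial.eval_comp, Polynomial.eval_add, Polynomial.eval_X, Polynomial.eval_C,
      zero_add] at h2
    simpa [hroot, hf, h2] using h1
  have hinj : Function.Injective fun t : F => algebraMap F L t * a := fun s t hst =>
    (algebraMap F L).injective (mul_right_cancel₀ ha hst)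
  have hmod : f %ₘ N = 0 := by
    refine Polynomial.eq_zero_of_natDegree_lt_card_of_eval_eq_zero _ hinj hroot' ?_
    have := Polynomial.natDegree_modByMonic_lt f hmon (by
      intro h
      rw [h] at hnat
      simp at hnat
      omega)
    rwa [hnat] at this
  set k := f /ₘ N with hk
  have hfac : g = Polynomial.C (g.eval 0) + N * k := by
    have := Polynomial.modByMonic_add_div f N
    rw [hmod, zero_add] at this
    rw [this, hf]
    ring
  have hkinv : ∀ t : F, k.comp (Polynomial.X + Polynomial.C (algebraMap F L t * a)) = k := by
    intro t
    have h1 := hg t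
    rw [hfac] at h1
    simp only [Polynomial.add_comp, Polynomial.mul_comp, Polynomial.C_comp, hNinv] at h1
    exact mul_left_cancel₀ hmon.ne_zero (by simpa using h1)
  have hkdeg : k.natDegree < n := by
    rw [hk, Polynomial.natDegree_divByMonic _ hmon, hnat, hf, Polynomial.natDegree_sub_C, hn]
    omega
  obtain ⟨h, hh⟩ := ih _ hkdeg k hkinv rfl
  refine ⟨Polynomial.C (g.eval 0) + Polynomial.X * h, ?_⟩
  conv_lhs => rw [hfac, hh]
  simp

end TranslationInvariants

section Hypersurface

variable (F : Type) [Field F]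

/-- The substitution `F[s][t][s'][t'] → R₂` given by
`s ↦ φ₁*`, `t ↦ φ₂*`, `s' ↦ φ₁`, `t' ↦ φ₂`. -/
def paramHom (q : ℕ) : PolyRing (PolyRing (PolyRing (PolyRing F))) →+* R2 F :=
  ev2 (ev2 C (X 3) (phi2s F q)) (X 0) (phi2 F q)

lemma u0_pow_card [Fintype F] (q : ℕ) (hF : Fintype.card F = q) :
    u0 F ^ q = (X 0 ^ (q - 1) * X 3 ^ (q - 1)) * u0 F +
      (X 0 ^ q * phi2s F q + X 3 ^ q * phi2 F q) := by
  obtain ⟨r, hr⟩ := Nat.exists_eq_add_of_le' (hF ▸ Fintype.card_pos : 0 < q)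
  have h : u0 F ^ q = (X 0 * X 2) ^ q + (X 1 * X 3) ^ q := by
    rw [u0, ← hF, add_pow_card_field (F := F)]
  rw [h, hr, u0, phi2, phi2s]
  simp only [Nat.add_sub_cancel]
  ring

lemma exists_eq_mul_of_sum_eq (q : ℕ) (hq : 1 < q)
    (c : Fin q → PolyRing (PolyRing (PolyRing (PolyRing F)))) (r : R2 F)
    (h : ∑ l, paramHom F q (c l) * u0 F ^ (l : ℕ) = X 0 * r) (l : Fin q) :
    ∃ w, c l = Polynomial.C Polynomial.X * w := by
  set N : PolyRing (PolyRing F) :=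
    Polynomial.X ^ q - Polynomial.X * Polynomial.C Polynomial.X ^ (q - 1) with hN
  have hNdeg : N.natDegree ≠ 0 := by
    have hlt : (Polynomial.X * Polynomial.C Polynomial.X ^ (q - 1) :
        PolyRing (PolyRing F)).degree < q := by
      rw [← Polynomial.C_pow, mul_comm]
      exact (Polynomial.degree_C_mul_X_le _).trans_lt (by exact_mod_cast hq)
    have hdeg : N.degree = q := by
      rw [hN, Polynomial.degree_sub_eq_left_of_degree_lt] <;> rw [Polynomial.degree_X_pow]
      exact hlt
    rw [Polynomial.natDegree_eq_of_degree_eq_some hdeg]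
    omega
  have hinj : Function.Injective (Polynomial.compRingHom N) := by
    rw [injective_iff_map_eq_zero]
    intro p hp
    rcases Polynomial.comp_eq_zero_iff.1 hp with hp | ⟨-, hp⟩
    · exact hp
    · exact absurd (by rw [hp]; simp) hNdeg
  let ρ : R2 F →+* PolyRing (PolyRing (PolyRing F)) :=
    eval₂Hom ((Polynomial.C.comp Polynomial.C).comp (Polynomial.C (R := F)))
      ![0, Polynomial.X, Polynomial.C Polynomial.X, Polynomial.C (Polynomial.C Polynomial.X)]
  have hρ : ρ.comp (paramHom F q) = (Polynomial.compRingHom (Polynomial.X ^ q)).comp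
      ((Polynomial.mapRingHom (Polynomial.compRingHom N)).comp
        (Polynomial.mapRingHom (Polynomial.evalRingHom 0))) := by
    have hq1 : q - 1 ≠ 0 := by omega
    ext <;> simp [paramHom, ρ, phi2, phi2s, hN, hq1]
  have hu : ρ (u0 F) = Polynomial.C (Polynomial.C Polynomial.X) * Polynomial.X := by
    simp only [ρ, u0, map_add, map_mul, eval₂Hom_X']
    simp [Polynomial.X_mul]
  have h1 := congrArg ρ h
  simp only [map_sum, map_mul, map_pow, hu] at h1
  simp only [← RingHom.comp_apply ρ, hρ] at h1
  have h2 := indepVia_comp_monic (Polynomial.X ^ q : PolyRing (PolyRing (PolyRing F)))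
    (Polynomial.monic_X_pow q) q (Polynomial.natDegree_X_pow q)
    (fun l => ((c l).map (Polynomial.evalRingHom 0)).map (Polynomial.compRingHom N) *
      Polynomial.C (Polynomial.C Polynomial.X) ^ (l : ℕ)) (by
      have h3 : ρ (X 0) = 0 := by simp [ρ]
      rw [h3, zero_mul] at h1
      rw [← h1]
      refine Finset.sum_congr rfl fun l _ => ?_
      simp [mul_pow, mul_assoc, Polynomial.map_map])
  have h4 := congrFun h2 l
  have h5 : (Polynomial.C (Polynomial.C Polynomial.X) ^ (l : ℕ) :
      PolyRing (PolyRing (PolyRing F))) ≠ 0 := pow_ne_zero _ (by simp [Polynomial.X_ne_zero])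
  have h6 := (mul_eq_zero.1 h4).resolve_right h5
  rw [Polynomial.map_eq_zero_iff hinj] at h6
  exact exists_eq_C_X_mul _ h6

lemma u0_pow_indep (q : ℕ) (hq : 1 < q) :
    IndepVia (A := PolyRing (PolyRing (PolyRing (PolyRing F)))) (B := R2 F)
      (paramHom F q) (fun l : Fin q => u0 F ^ (l : ℕ)) := by
  refine fun c hc => eq_zero_of_descent (Polynomial.C Polynomial.X) eq_zero_of_C_X_pow_dvd
    (fun c => ∑ l : Fin q, paramHom F q (c l) * u0 F ^ (l : ℕ) = 0) ?_ c hc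
  intro c hc
  choose c' hc' using exists_eq_mul_of_sum_eq F q hq c 0 (by rw [hc, mul_zero])
  refine ⟨c', ?_, hc'⟩
  refine (mul_eq_zero.1 (?_ : (X 0 : R2 F) * _ = 0)).resolve_left (X_ne_zero 0)
  rw [← hc, Finset.mul_sum]
  refine Finset.sum_congr rfl fun l _ => ?_
  rw [hc' l, map_mul]
  simp only [paramHom, ev2_C_X]
  ring

/-- The extension of `paramHom` by a variable sent to `u₀`. -/
def paramHomU (q : ℕ) : PolyRing (PolyRing (PolyRing (PolyRing (PolyRing F)))) →+* R2 F :=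
  Polynomial.eval₂RingHom (paramHom F q) (u0 F)

lemma exists_sum_eq_paramHomU [Fintype F] (q : ℕ) (hF : Fintype.card F = q)
    (g : PolyRing (PolyRing (PolyRing (PolyRing (PolyRing F))))) :
    ∃ c : Fin q → _, ∑ l, paramHom F q (c l) * u0 F ^ (l : ℕ) = paramHomU F q g := by
  have hq1 : 1 < q := hF ▸ Fintype.one_lt_card
  let α : PolyRing (PolyRing (PolyRing (PolyRing F))) :=
    Polynomial.C Polynomial.X ^ (q - 1) *
      Polynomial.C (Polynomial.C (Polynomial.C Polynomial.X)) ^ (q - 1)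
  let β : PolyRing (PolyRing (PolyRing (PolyRing F))) :=
    Polynomial.C Polynomial.X ^ q * Polynomial.C (Polynomial.C Polynomial.X) +
      Polynomial.C (Polynomial.C (Polynomial.C Polynomial.X)) ^ q * Polynomial.X
  have hα : paramHom F q α = X 0 ^ (q - 1) * X 3 ^ (q - 1) := by simp [α, paramHom]
  have hβ : paramHom F q β = X 0 ^ q * phi2s F q + X 3 ^ q * phi2 F q := by simp [β, paramHom]
  set H : PolyRing (PolyRing (PolyRing (PolyRing (PolyRing F)))) :=
    Polynomial.X ^ q - (Polynomial.C α * Polynomial.X + Polynomial.C β) with hH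
  have hlt : (Polynomial.C α * Polynomial.X + Polynomial.C β).degree < (q : WithBot ℕ) :=
    Polynomial.degree_linear_le.trans_lt (by exact_mod_cast hq1)
  have hmon : H.Monic := Polynomial.monic_X_pow_sub hlt
  have hdeg : H.degree = q := by
    rw [hH, Polynomial.degree_sub_eq_left_of_degree_lt] <;> rw [Polynomial.degree_X_pow]
    exact hlt
  have hH0 : paramHomU F q H = 0 := by
    simp only [paramHomU, Polynomial.coe_eval₂RingHom, hH, Polynomial.eval₂_sub,
      Polynomial.eval₂_X_pow, Polynomial.eval₂_add, Polynomial.eval₂_mul, Polynomial.eval₂_C,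
      Polynomial.eval₂_X, hα, hβ]
    rw [u0_pow_card F q hF, sub_self]
  refine ⟨fun l => (g %ₘ H).coeff l, ?_⟩
  conv_rhs => rw [← Polynomial.modByMonic_add_div g H, map_add, map_mul, hH0, zero_mul, add_zero]
  have hnat : (g %ₘ H).natDegree < q := by
    have := Polynomial.natDegree_modByMonic_lt g hmon (by
      intro h
      rw [h, Polynomial.degree_one] at hdeg
      have : q = 0 := by exact_mod_cast hdeg.symm
      omega)
    rwa [Polynomial.natDegree_eq_of_degree_eq_some hdeg] at this
  rw [paramHomU, Polynomial.coe_eval₂RingHom, Polynomial.eval₂_eq_sum_range' _ hnat,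
    Finset.sum_range]

end Hypersurface

section Invariants

variable {F : Type} [Field F]

/-- The element of `P₂` with upper right entry `t`. -/
def unipotent (t : F) : GL (Fin 2) F :=
  Matrix.GeneralLinearGroup.mkOfDetNeZero !![1, t; 0, 1] (by simp)

lemma unipotent_mem (t : F) : unipotent t ∈ P2 F := by
  refine ⟨?_, ?_, ?_⟩ <;> simp [unipotent, Matrix.GeneralLinearGroup.mkOfDetNeZero]

lemma eq_unipotent {A : GL (Fin 2) F} (hA : A ∈ P2 F) : A = unipotent (A.val 0 1) := by
  obtain ⟨h1, h2, h3⟩ := hA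
  ext i j
  fin_cases i <;> fin_cases j <;>
    simp [unipotent, Matrix.GeneralLinearGroup.mkOfDetNeZero, h1, h2, h3]

lemma act_unipotent (t : F) : act (unipotent t) =
    aeval ![X 0, X 1 - C t * X 0, X 2 + C t * X 3, X 3] := by
  simp [act, unipotent, Matrix.GeneralLinearGroup.mkOfDetNeZero]

lemma u0_mem : u0 F ∈ invariantRing (P2 F) := by
  intro A hA
  rw [eq_unipotent hA, act_unipotent]
  simp [u0]
  ring

lemma paramHom_mem [Fintype F] (q : ℕ) (hF : Fintype.card F = q)
    (w : PolyRing (PolyRing (PolyRing (PolyRing F)))) :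
    paramHom F q w ∈ invariantRing (P2 F) := by
  intro A hA
  rw [eq_unipotent hA, act_unipotent]
  set t := A.val 0 1
  have h1 := add_smul_orbit_poly (-t) (X 1 : R2 F) (X 0)
  have h2 := add_smul_orbit_poly t (X 2 : R2 F) (X 3)
  rw [hF] at h1 h2
  have h : ((aeval ![X 0, X 1 - C t * X 0, X 2 + C t * X 3, X 3] : R2 F →ₐ[F] R2 F) :
      R2 F →+* R2 F).comp (paramHom F q) = paramHom F q := by
    rw [paramHom, comp_ev2, comp_ev2]
    congr 1
    · congr 1
      · ext; simp
      · simp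
      · simpa [phi2s] using h2
    · simp
    · simpa [phi2, sub_eq_add_neg] using h1
  exact RingHom.congr_fun h w

/-- The substitution `F[a,u,d][b] → R₂` sending `a, u, d, b` to `x₁, u₀, y₂, x₂`. -/
def etaHom (F : Type) [Field F] : PolyRing (MvPolynomial (Fin 3) F) →+* R2 F :=
  Polynomial.eval₂RingHom (eval₂Hom C ![X 0, u0 F, X 3]) (X 1)

lemma etaHom_injective : Function.Injective (etaHom F) := by
  let K := FractionRing (MvPolynomial (Fin 3) F)
  let i : MvPolynomial (Fin 3) F →+* K := algebraMap _ _
  have hi : Function.Injective i := IsFractionRing.injective _ _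
  have h0 : i (X 0) ≠ 0 := by
    rw [Ne, map_eq_zero_iff _ hi]
    exact X_ne_zero 0
  let lam : R2 F →+* Polynomial K := eval₂Hom (Polynomial.C.comp (i.comp C))
    ![Polynomial.C (i (X 0)), Polynomial.X,
      Polynomial.C (i (X 1) / i (X 0)) - Polynomial.C (i (X 2) / i (X 0)) * Polynomial.X,
      Polynomial.C (i (X 2))]
  have h : lam.comp (etaHom F) = Polynomial.mapRingHom i := by
    refine Polynomial.ringHom_ext' (MvPolynomial.ringHom_ext ?_ ?_) ?_
    · intro r
      simp [lam, etaHom]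
    · intro j
      fin_cases j
      · simp [lam, etaHom]
      · simp [lam, etaHom, u0]
        rw [mul_sub, ← mul_assoc, ← Polynomial.C_mul, ← Polynomial.C_mul, mul_div_cancel₀ _ h0,
          mul_div_cancel₀ _ h0]
        ring
      · simp [lam, etaHom]
    · simp [lam, etaHom]
  refine Function.Injective.of_comp (f := lam) ?_
  rw [← RingHom.coe_comp, h]
  exact Polynomial.map_injective _ hi

lemma exists_mul_eq_etaHom (f : R2 F) : ∃ k g, X 0 ^ k * f = etaHom F g := by
  induction f using MvPolynomial.induction_on with
  | C r => exact ⟨0, Polynomial.C (C r), by simp [etaHom]⟩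
  | add f f' hf hf' =>
    obtain ⟨k, g, h⟩ := hf
    obtain ⟨k', g', h'⟩ := hf'
    refine ⟨k + k', Polynomial.C (X 0) ^ k' * g + Polynomial.C (X 0) ^ k * g', ?_⟩
    have hX : etaHom F (Polynomial.C (X 0)) = X 0 := by simp [etaHom]
    rw [map_add, map_mul, map_mul, map_pow, map_pow, hX, ← h, ← h']
    ring
  | mul_X f j hf =>
    obtain ⟨k, g, h⟩ := hf
    have hj : ∃ k' g', X 0 ^ k' * (X j : R2 F) = etaHom F g' := by
      fin_cases j
      · exact ⟨0, Polynomial.C (X 0), by simp [etaHom]⟩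
      · exact ⟨0, Polynomial.X, by simp [etaHom]⟩
      · refine ⟨1, Polynomial.C (X 1) - Polynomial.X * Polynomial.C (X 2), ?_⟩
        simp [etaHom, u0]
        ring
      · exact ⟨0, Polynomial.C (X 2), by simp [etaHom]⟩
    obtain ⟨k', g', h'⟩ := hj
    refine ⟨k + k', g * g', ?_⟩
    rw [map_mul, ← h, ← h']
    ring

lemma exists_mul_eq_paramHomU [Fintype F] (q : ℕ) (hF : Fintype.card F = q) (f : R2 F)
    (hf : f ∈ invariantRing (P2 F)) : ∃ k g, X 0 ^ k * f = paramHomU F q g := by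
  obtain ⟨k, g, hg⟩ := exists_mul_eq_etaHom f
  have hinv : ∀ t : F, g.comp (Polynomial.X +
      Polynomial.C (algebraMap F (MvPolynomial (Fin 3) F) t * X 0)) = g := by
    intro t
    apply etaHom_injective
    have h1 : ((act (unipotent (-t)) : R2 F →ₐ[F] R2 F) : R2 F →+* R2 F).comp (etaHom F) =
        (etaHom F).comp (Polynomial.compRingHom (Polynomial.X +
          Polynomial.C (algebraMap F (MvPolynomial (Fin 3) F) t * X 0))) := by
      rw [act_unipotent]
      refine Polynomial.ringHom_ext' (MvPolynomial.ringHom_ext ?_ ?_) ?_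
      · intro r
        simp [etaHom]
      · intro j
        fin_cases j
        · simp [etaHom]
        · simp [etaHom, u0]
          ring
        · simp [etaHom]
      · simp [etaHom, MvPolynomial.algebraMap_eq]
    have h2 := RingHom.congr_fun h1 g
    simp only [RingHom.comp_apply, Polynomial.coe_compRingHom_apply] at h2
    rw [← h2, ← hg]
    change act _ _ = _
    rw [map_mul, hf _ (unipotent_mem _), map_pow, act_unipotent]
    simp
  obtain ⟨h, hh⟩ := exists_comp_of_translation_invariant _ (X_ne_zero 0) g hinv
  let θ : PolyRing (MvPolynomial (Fin 3) F) →+*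
      PolyRing (PolyRing (PolyRing (PolyRing (PolyRing F)))) :=
    Polynomial.eval₂RingHom
      (eval₂Hom ((((Polynomial.C.comp Polynomial.C).comp Polynomial.C).comp
        Polynomial.C).comp (Polynomial.C (R := F)))
        ![Polynomial.C (Polynomial.C Polynomial.X), Polynomial.X,
          Polynomial.C (Polynomial.C (Polynomial.C (Polynomial.C Polynomial.X)))])
      (Polynomial.C Polynomial.X)
  have hθ : (paramHomU F q).comp θ = (etaHom F).comp (Polynomial.compRingHom
      (Polynomial.X ^ Fintype.card F -
        Polynomial.X * Polynomial.C (X 0) ^ (Fintype.card F - 1))) := by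
    refine Polynomial.ringHom_ext' (MvPolynomial.ringHom_ext ?_ ?_) ?_
    · intro r
      simp [etaHom, paramHomU, paramHom, θ]
    · intro j
      fin_cases j <;> simp [etaHom, paramHomU, paramHom, θ]
    · simp [etaHom, paramHomU, paramHom, θ, phi2, hF, Polynomial.eval₂_pow]
  refine ⟨k, θ h, ?_⟩
  rw [hg, hh]
  exact (RingHom.congr_fun hθ h).symm

lemma u0_pow_span [Fintype F] (q : ℕ) (hF : Fintype.card F = q) :
    SpanVia (A := PolyRing (PolyRing (PolyRing (PolyRing F)))) (B := R2 F)
      (paramHom F q) (fun l : Fin q => u0 F ^ (l : ℕ)) (invariantRing (P2 F)) := by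
  intro f hf
  obtain ⟨k, g, hg⟩ := exists_mul_eq_paramHomU q hF f hf
  obtain ⟨c, hc⟩ := exists_sum_eq_paramHomU F q hF g
  rw [← hg] at hc
  clear hg
  induction k generalizing c with
  | zero => exact ⟨c, by simpa using hc⟩
  | succ k ih =>
    choose c' hc' using exists_eq_mul_of_sum_eq F q (hF ▸ Fintype.one_lt_card) c (X 0 ^ k * f)
      (by rw [hc]; ring)
    refine ih c' (mul_left_cancel₀ (X_ne_zero 0 : (X 0 : R2 F) ≠ 0) ?_)
    rw [← mul_assoc, ← pow_succ', ← hc, Finset.mul_sum]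
    refine Finset.sum_congr rfl fun l _ => ?_
    rw [hc' l, map_mul]
    simp only [paramHom, ev2_C_X]
    ring

end Invariants

section Dickson

variable (F : Type) [Field F]

/-- The substitution of the four Dickson invariants (up to sign) into polynomials in four
variables. -/
def totalHom (q : ℕ) : PolyRing (PolyRing (PolyRing (PolyRing F))) →+* R2 F :=
  ev2 (ev2 C (X 3 * phi2s F q) (phi2s F q ^ (q - 1) + X 3 ^ (q * (q - 1))))
    (X 0 * phi2 F q) (phi2 F q ^ (q - 1) + X 0 ^ (q * (q - 1)))

lemma paramHom_comp_dicksonHom (q : ℕ) :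
    (paramHom F q).comp ((dicksonHom (PolyRing (PolyRing F)) (q - 1) (q * (q - 1))).comp
      (Polynomial.mapRingHom (Polynomial.mapRingHom (dicksonHom F (q - 1) (q * (q - 1)))))) =
      totalHom F q := by
  refine Polynomial.ringHom_ext' (Polynomial.ringHom_ext'
    (Polynomial.ringHom_ext' (Polynomial.ringHom_ext' ?_ ?_) ?_) ?_) ?_
  · ext r
    simp [paramHom, dicksonHom, totalHom]
  all_goals simp [paramHom, dicksonHom, totalHom]

lemma exists_basis_totalHom [Fintype F] (q : ℕ) (hF : Fintype.card F = q) :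
    ∃ e : Fin q × ((Fin (q - 1) ⊕ Fin (q * (q - 1))) × (Fin (q - 1) ⊕ Fin (q * (q - 1)))) → R2 F,
      IndepVia (totalHom F q) e ∧ SpanVia (totalHom F q) e (invariantRing (P2 F)) ∧
        ∀ i, e i ∈ invariantRing (P2 F) := by
  have hq : 1 < q := hF ▸ Fintype.one_lt_card
  have hm : 0 < q - 1 := by omega
  have hn : 0 < q * (q - 1) := Nat.mul_pos (by omega) hm
  rw [← paramHom_comp_dicksonHom]
  have i1 := ((dickson_indep (S := F) _ _ hm hn).map.map).comp
    (dickson_indep (S := PolyRing (PolyRing F)) _ _ hm hn)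
  have s1 := ((dickson_span (S := F) _ _ hm hn).map.map).comp
    (dickson_span (S := PolyRing (PolyRing F)) _ _ hm hn)
  have i2 := i1.comp (u0_pow_indep F q hq)
  have s2 := s1.comp (u0_pow_span q hF)
  exact ⟨_, i2, s2, fun i => mul_mem (paramHom_mem q hF _) (pow_mem u0_mem _)⟩

variable {F}

lemma d22_eq (q : ℕ) (hq : 1 < q) : d22 F q = -(X 0 * phi2 F q) := by
  obtain ⟨r, rfl⟩ := Nat.exists_eq_add_of_le' hq.le
  simp only [d22, phi2, Nat.add_sub_cancel]
  ring

lemma d22s_eq (q : ℕ) (hq : 1 < q) : d22s F q = -(X 3 * phi2s F q) := by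
  obtain ⟨r, rfl⟩ := Nat.exists_eq_add_of_le' hq.le
  simp only [d22s, phi2s, Nat.add_sub_cancel]
  ring

lemma phi2_ne_zero (q : ℕ) (hq : 1 < q) : phi2 F q ≠ 0 := by
  intro h
  have h1 := congrArg (MvPolynomial.eval ![0, 1, 0, 0]) h
  simp [phi2, show q - 1 ≠ 0 by omega] at h1

lemma phi2s_ne_zero (q : ℕ) (hq : 1 < q) : phi2s F q ≠ 0 := by
  intro h
  have h1 := congrArg (MvPolynomial.eval ![0, 0, 1, 0]) h
  simp [phi2s, show q - 1 ≠ 0 by omega] at h1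

lemma dickson_quotient [Fintype F] (q : ℕ) (hF : Fintype.card F = q) (x y p c : R2 F)
    (hx : x ≠ 0) (hp : p = y ^ q - y * x ^ (q - 1)) (hp0 : p ≠ 0)
    (h : -(x * p) * c = y * x ^ (q ^ 2) - x * y ^ (q ^ 2)) :
    c = p ^ (q - 1) + x ^ (q * (q - 1)) := by
  have hq : 0 < q := hF ▸ Fintype.card_pos
  have hpq : p ^ q = y ^ (q ^ 2) - y ^ q * x ^ (q * (q - 1)) := by
    have h1 := add_pow_card_field (F := F) p (y * x ^ (q - 1))
    rw [hF, show p + y * x ^ (q - 1) = y ^ q by rw [hp]; ring, ← pow_mul, ← pow_two] at h1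
    rw [h1, mul_pow, ← pow_mul, mul_comm (q - 1) q]
    ring
  refine mul_left_cancel₀ (mul_ne_zero hx hp0) ?_
  have h2 : p * p ^ (q - 1) = p ^ q := by rw [← pow_succ', Nat.sub_add_cancel hq]
  have h3 : x ^ (q ^ 2) = x ^ (q - 1) * x ^ (q * (q - 1)) * x := by
    obtain ⟨r, rfl⟩ := Nat.exists_eq_add_of_le' hq
    simp only [Nat.add_sub_cancel]
    ring
  calc x * p * c = -(y * x ^ (q ^ 2) - x * y ^ (q ^ 2)) := by rw [← h]; ring
    _ = x * (p ^ q + p * x ^ (q * (q - 1))) := by rw [hpq, h3, hp]; ring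
    _ = x * p * (p ^ (q - 1) + x ^ (q * (q - 1))) := by rw [← h2]; ring

lemma mem_adjoin_iff_totalHom [Fintype F] (q : ℕ) (hF : Fintype.card F = q) (c21 c21s : R2 F)
    (hc21 : d22 F q * c21 = X 1 * X 0 ^ (q ^ 2) - X 0 * X 1 ^ (q ^ 2))
    (hc21s : d22s F q * c21s = X 2 * X 3 ^ (q ^ 2) - X 3 * X 2 ^ (q ^ 2)) (f : R2 F) :
    f ∈ Algebra.adjoin F {d22 F q, c21, d22s F q, c21s} ↔ ∃ z, totalHom F q z = f := by
  have hq : 1 < q := hF ▸ Fintype.one_lt_card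
  rw [d22_eq q hq] at hc21 ⊢
  rw [d22s_eq q hq] at hc21s ⊢
  obtain rfl := dickson_quotient q hF (X 0) (X 1) _ c21 (X_ne_zero 0) rfl (phi2_ne_zero q hq) hc21
  obtain rfl := dickson_quotient q hF (X 3) (X 2) _ c21s (X_ne_zero 3) rfl
    (phi2s_ne_zero q hq) hc21s
  constructor
  · intro hf
    induction hf using Algebra.adjoin_induction with
    | mem x hx =>
      rcases hx with rfl | rfl | rfl | rfl
      · exact ⟨-(Polynomial.C Polynomial.X :
          PolyRing (PolyRing (PolyRing (PolyRing F)))), by simp [totalHom]⟩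
      · exact ⟨Polynomial.X, by simp [totalHom, phi2]⟩
      · exact ⟨-(Polynomial.C (Polynomial.C (Polynomial.C Polynomial.X)) :
          PolyRing (PolyRing (PolyRing (PolyRing F)))), by simp [totalHom]⟩
      · exact ⟨Polynomial.C (Polynomial.C Polynomial.X), by simp [totalHom, phi2s]⟩
    | algebraMap r =>
      exact ⟨Polynomial.C (Polynomial.C (Polynomial.C (Polynomial.C r))), by
        simp [totalHom, MvPolynomial.algebraMap_eq]⟩
    | add x y _ _ hx hy =>
      obtain ⟨a, rfl⟩ := hx
      obtain ⟨b, rfl⟩ := hy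
      exact ⟨a + b, map_add _ _ _⟩
    | mul x y _ _ hx hy =>
      obtain ⟨a, rfl⟩ := hx
      obtain ⟨b, rfl⟩ := hy
      exact ⟨a * b, map_mul _ _ _⟩
  · rintro ⟨z, rfl⟩
    set T := Algebra.adjoin F {-(X 0 * phi2 F q), phi2 F q ^ (q - 1) + X 0 ^ (q * (q - 1)),
      -(X 3 * phi2s F q), phi2s F q ^ (q - 1) + X 3 ^ (q * (q - 1))} with hT
    have hev : ∀ {S : Type} [CommRing S] (g : S →+* R2 F) (a b : R2 F), (∀ s, g s ∈ T) →
        a ∈ T → b ∈ T → ∀ w, ev2 g a b w ∈ T := by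
      intro S _ g a b hg ha hb w
      induction w using Polynomial.induction_on' with
      | add p q hp hq => rw [map_add]; exact add_mem hp hq
      | monomial k v =>
        rw [← Polynomial.C_mul_X_pow_eq_monomial, map_mul, map_pow, ev2_X]
        refine mul_mem ?_ (pow_mem hb _)
        induction v using Polynomial.induction_on' with
        | add p q hp hq => rw [map_add, map_add]; exact add_mem hp hq
        | monomial k s =>
          rw [← Polynomial.C_mul_X_pow_eq_monomial, map_mul, map_mul, map_pow, map_pow, ev2_C_X,
            ev2_C_C]
          exact mul_mem (hg s) (pow_mem ha _)
    have h1 : -(X 0 * phi2 F q) ∈ T := Algebra.subset_adjoin (by simp)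
    have h2 : -(X 3 * phi2s F q) ∈ T := Algebra.subset_adjoin (by simp)
    refine hev _ _ _ (hev _ _ _ (fun s => ?_) ?_ (Algebra.subset_adjoin (by simp))) ?_
      (Algebra.subset_adjoin (by simp)) z
    · exact T.algebraMap_mem s
    · simpa using neg_mem h2
    · simpa using neg_mem h1

end Dickson

/-- `R₂^{P₂}` is a free module over the subalgebra
`𝒜 = F_q[d₂₂, c₂₁, d₂₂*, c₂₁*]` of rank `q(q²−1)²`. -/
theorem stmt_0 (q : ℕ) (hq : IsPrimePow q) (F : Type) [Field F] [Fintype F]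
    (hF : Fintype.card F = q)
    (c21 c21s : R2 F)
    (hc21 : d22 F q * c21 = X 1 * X 0 ^ (q ^ 2) - X 0 * X 1 ^ (q ^ 2))
    (hc21s : d22s F q * c21s = X 2 * X 3 ^ (q ^ 2) - X 3 * X 2 ^ (q ^ 2)) :
    ∃ B : Finset (R2 F),
      B.card = q * (q ^ 2 - 1) ^ 2 ∧
      (B : Set (R2 F)) ⊆ (invariantRing (P2 F) : Set (R2 F)) ∧
      (∀ f ∈ invariantRing (P2 F),
        f ∈ Submodule.span (Algebra.adjoin F {d22 F q, c21, d22s F q, c21s})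
          (B : Set (R2 F))) ∧
      LinearIndependent (Algebra.adjoin F {d22 F q, c21, d22s F q, c21s})
        (fun b : (B : Set (R2 F)) => (b : R2 F)) := by
  classical
  obtain ⟨e, hind, hspan, hmem⟩ := exists_basis_totalHom F q hF
  have hadj := mem_adjoin_iff_totalHom q hF c21 c21s hc21 hc21s
  have hli : LinearIndependent (Algebra.adjoin F {d22 F q, c21, d22s F q, c21s}) e := by
    rw [Fintype.linearIndependent_iff]
    intro g hg i
    choose c hc using fun i => (hadj (g i)).1 (g i).2
    have h0 : c = 0 := hind c (by
      rw [← hg]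
      exact Finset.sum_congr rfl fun i _ => by rw [hc, Subalgebra.smul_def, smul_eq_mul])
    refine Subtype.ext ?_
    rw [← hc i, h0, Pi.zero_apply, map_zero]
    rfl
  have hB : ((Finset.univ.image e : Finset (R2 F)) : Set (R2 F)) = Set.range e := by simp
  refine ⟨Finset.univ.image e, ?_, ?_, ?_, ?_⟩
  · rw [Finset.card_image_of_injective _ hli.injective, Finset.card_univ]
    simp only [Fintype.card_prod, Fintype.card_sum, Fintype.card_fin]
    obtain ⟨r, hr⟩ : ∃ r, q = r + 1 := Nat.exists_eq_add_of_le' (hF ▸ Fintype.card_pos)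
    rw [hr, Nat.add_sub_cancel, show (r + 1) ^ 2 - 1 = r + (r + 1) * r by
      rw [Nat.sub_eq_iff_eq_add (Nat.one_le_pow _ _ (by omega))]; ring]
    ring
  · rw [hB]
    rintro _ ⟨i, rfl⟩
    exact hmem i
  · intro f hf
    obtain ⟨c, rfl⟩ := hspan f hf
    refine Submodule.sum_mem _ fun i _ => ?_
    exact Submodule.smul_mem _
      (⟨totalHom F q (c i), (hadj _).2 ⟨_, rfl⟩⟩ :
        Algebra.adjoin F {d22 F q, c21, d22s F q, c21s})
      (Submodule.subset_span (by simp))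
  · rw [hB]
    exact hli.linearIndepOn_id
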